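/- arXiv:quant-ph/0411095 — 3 statements merged into one kernel-verified Lean document; each statement's English description precedes it below -/
import Mathlib

section
/- If Λ is a positive map on M_d(ℂ), ρ is a PPT density matrix on ℂ^d⊗ℂ^d, and D_Λ[ρ] := Tr[((id_d⊗Λ)[P⁺_d])·ρ] < 0, then Λ is not decomposable and ρ is entangled. -/
open Matrix
open scoped Kronecker ComplexOrder

noncomputable section

/-- A linear map on matrices is *positive* if it sends positive semidefinite
matrices to positive semidefinite matrices. -/
def IsPosMap {q : Type*} [Fintype q] (Λ : Matrix q q ℂ →ₗ[ℂ] Matrix q q ℂ) : Prop :=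
  ∀ ρ : Matrix q q ℂ, ρ.PosSemidef → (Λ ρ).PosSemidef

/-- `id ⊗ Λ` : the map acting as the identity on the first tensor factor and as `Λ`
on the second, written blockwise. -/
def idTensor {p q : Type*} (Λ : Matrix q q ℂ → Matrix q q ℂ)
    (ρ : Matrix (p × q) (p × q) ℂ) : Matrix (p × q) (p × q) ℂ :=
  Matrix.of fun x y => Λ (Matrix.of fun a b => ρ (x.1, a) (y.1, b)) x.2 y.2

/-- Complete positivity: all the extensions `id_n ⊗ Λ` are positive. -/
def CompletelyPositive {q : Type*} [Fintype q] (Λ : Matrix q q ℂ →ₗ[ℂ] Matrix q q ℂ) : Prop :=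
  ∀ n : ℕ, ∀ ρ : Matrix (Fin n × q) (Fin n × q) ℂ, ρ.PosSemidef → (idTensor (⇑Λ) ρ).PosSemidef

/-- The maximally entangled vector `|Ψ⁺⟩ = (1/√d) ∑ⱼ |j⟩⊗|j⟩`. -/
def maxEntVec (q : Type*) [Fintype q] [DecidableEq q] : q × q → ℂ :=
  fun x => if x.1 = x.2 then (((Real.sqrt (Fintype.card q) : ℝ) : ℂ))⁻¹ else 0

/-- The projection `P⁺ = |Ψ⁺⟩⟨Ψ⁺|` onto the maximally entangled vector. -/
def Pplus (q : Type*) [Fintype q] [DecidableEq q] : Matrix (q × q) (q × q) ℂ :=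
  vecMulVec (maxEntVec q) (star (maxEntVec q))

/-- Separability of a bipartite density matrix: a finite convex combination of tensor
products of density matrices. -/
def Separable {q : Type*} [Fintype q] (ρ : Matrix (q × q) (q × q) ℂ) : Prop :=
  ∃ (n : ℕ) (c : Fin n → ℝ) (ρ₁ ρ₂ : Fin n → Matrix q q ℂ),
    (∀ i, 0 ≤ c i) ∧ (∑ i, c i) = 1 ∧
    (∀ i, (ρ₁ i).PosSemidef ∧ (ρ₁ i).trace = 1) ∧
    (∀ i, (ρ₂ i).PosSemidef ∧ (ρ₂ i).trace = 1) ∧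
    ρ = ∑ i, (c i : ℂ) • (ρ₁ i ⊗ₖ ρ₂ i)

/-- Transposition as a linear map on matrices. -/
def transposeLM (q : Type*) : Matrix q q ℂ →ₗ[ℂ] Matrix q q ℂ where
  toFun := Matrix.transpose
  map_add' A B := Matrix.transpose_add A B
  map_smul' c A := Matrix.transpose_smul c A

/-- Partial transposition on the first tensor factor. -/
def ptFst {p q : Type*} (ρ : Matrix (p × q) (p × q) ℂ) : Matrix (p × q) (p × q) ℂ :=
  Matrix.of fun x y => ρ (y.1, x.2) (x.1, y.2)

/-- A bipartite state is PPT if its partial transpose is positive semidefinite. -/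
def IsPPT {p q : Type*} [Fintype p] [Fintype q] (ρ : Matrix (p × q) (p × q) ℂ) : Prop :=
  (ptFst ρ).PosSemidef

/-- A map is decomposable if it is the sum of a completely positive map and a
completely positive map composed with transposition. -/
def Decomposable {q : Type*} [Fintype q] (Λ : Matrix q q ℂ →ₗ[ℂ] Matrix q q ℂ) : Prop :=
  ∃ Γ₁ Γ₂ : Matrix q q ℂ →ₗ[ℂ] Matrix q q ℂ,
    CompletelyPositive Γ₁ ∧ CompletelyPositive Γ₂ ∧ Λ = Γ₁ + Γ₂ ∘ₗ transposeLM q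

open scoped MatrixOrder Matrix.Norms.L2Operator in
theorem Matrix.PosSemidef.trace_mul_nonneg {n : Type*} [Fintype n] {A B : Matrix n n ℂ}
    (hA : A.PosSemidef) (hB : B.PosSemidef) : 0 ≤ (A * B).trace := by
  classical
  obtain ⟨C, rfl⟩ := CStarAlgebra.nonneg_iff_eq_star_mul_self.mp hB.nonneg
  rw [← Matrix.mul_assoc, Matrix.trace_mul_comm, ← Matrix.mul_assoc, Matrix.star_eq_conjTranspose]
  exact (hA.mul_mul_conjTranspose_same C).trace_nonneg

theorem Pplus_posSemidef (q : Type*) [Fintype q] [DecidableEq q] : (Pplus q).PosSemidef :=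
  Matrix.posSemidef_vecMulVec_self_star _

theorem trace_ptFst_mul {p q : Type*} [Fintype p] [Fintype q]
    (A B : Matrix (p × q) (p × q) ℂ) : (ptFst A * B).trace = (A * ptFst B).trace := by
  simp only [Matrix.trace, Matrix.diag_apply, Matrix.mul_apply, ptFst, Matrix.of_apply,
    Fintype.sum_prod_type]
  rw [Finset.sum_congr rfl fun _ _ => Finset.sum_comm, Finset.sum_comm]
  exact Finset.sum_congr rfl fun _ _ => Finset.sum_comm

/-- The blocks of `P⁺` are the matrix units, up to normalisation. -/
theorem Pplus_block {q : Type*} [Fintype q] [DecidableEq q] (i j : q) :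
    (Matrix.of fun a b => Pplus q (i, a) (j, b)) =
      ((Fintype.card q : ℂ)⁻¹) • Matrix.single i j (1 : ℂ) := by
  ext a b
  have h : ((Real.sqrt (Fintype.card q) : ℝ) : ℂ) * ((Real.sqrt (Fintype.card q) : ℝ) : ℂ) =
      (Fintype.card q : ℂ) := by
    rw [← Complex.ofReal_mul, Real.mul_self_sqrt (Nat.cast_nonneg _), Complex.ofReal_natCast]
  by_cases hia : i = a <;> by_cases hjb : j = b <;>
    simp [Pplus, maxEntVec, Matrix.vecMulVec_apply, hia, hjb, ← h]

theorem idTensor_Pplus_apply {q : Type*} [Fintype q] [DecidableEq q]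
    (Λ : Matrix q q ℂ →ₗ[ℂ] Matrix q q ℂ) (x y : q × q) :
    idTensor (⇑Λ) (Pplus q) x y =
      (Fintype.card q : ℂ)⁻¹ * Λ (Matrix.single x.1 y.1 1) x.2 y.2 := by
  simp only [idTensor, Matrix.of_apply, Pplus_block, map_smul, Matrix.smul_apply, smul_eq_mul]

theorem idTensor_add_Pplus {q : Type*} [Fintype q] [DecidableEq q]
    (Γ₁ Γ₂ : Matrix q q ℂ →ₗ[ℂ] Matrix q q ℂ) :
    idTensor (⇑(Γ₁ + Γ₂ ∘ₗ transposeLM q)) (Pplus q) =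
      idTensor (⇑Γ₁) (Pplus q) + ptFst (idTensor (⇑Γ₂) (Pplus q)) := by
  ext x y
  simp [idTensor_Pplus_apply, ptFst, transposeLM, mul_add]

theorem trace_idTensor_Pplus_mul_kronecker {q : Type*} [Fintype q] [DecidableEq q]
    (Λ : Matrix q q ℂ →ₗ[ℂ] Matrix q q ℂ) (σ τ : Matrix q q ℂ) :
    (idTensor (⇑Λ) (Pplus q) * (σ ⊗ₖ τ)).trace =
      (Fintype.card q : ℂ)⁻¹ * (Λ σᵀ * τ).trace := by
  have hσ : Λ σᵀ = ∑ i, ∑ j, σ j i • Λ (Matrix.single i j 1) := by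
    conv_lhs => rw [Matrix.matrix_eq_sum_single σᵀ]
    simp only [map_sum, ← map_smul, Matrix.smul_single, Matrix.transpose_apply, smul_eq_mul,
      mul_one]
  rw [hσ]
  simp only [Matrix.trace, Matrix.diag_apply, Matrix.mul_apply, idTensor_Pplus_apply,
    Fintype.sum_prod_type, Matrix.kroneckerMap_apply, Matrix.sum_apply, Matrix.smul_apply,
    smul_eq_mul, Finset.sum_mul, Finset.mul_sum]
  rw [Finset.sum_comm]
  refine Finset.sum_congr rfl fun _ _ => Finset.sum_congr rfl fun _ _ =>
    Finset.sum_congr rfl fun _ _ => Finset.sum_congr rfl fun _ _ => ?_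
  ring

theorem Decomposable.trace_nonneg_of_isPPT {d : ℕ}
    {Λ : Matrix (Fin d) (Fin d) ℂ →ₗ[ℂ] Matrix (Fin d) (Fin d) ℂ} (hΛ : Decomposable Λ)
    {ρ : Matrix (Fin d × Fin d) (Fin d × Fin d) ℂ} (hρ : ρ.PosSemidef) (hppt : IsPPT ρ) :
    0 ≤ (idTensor (⇑Λ) (Pplus (Fin d)) * ρ).trace := by
  obtain ⟨Γ₁, Γ₂, h₁, h₂, rfl⟩ := hΛ
  rw [idTensor_add_Pplus, Matrix.add_mul, Matrix.trace_add, trace_ptFst_mul]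
  exact add_nonneg ((h₁ d _ (Pplus_posSemidef _)).trace_mul_nonneg hρ)
    ((h₂ d _ (Pplus_posSemidef _)).trace_mul_nonneg hppt)

theorem Separable.trace_nonneg_of_isPosMap {q : Type*} [Fintype q] [DecidableEq q]
    {Λ : Matrix q q ℂ →ₗ[ℂ] Matrix q q ℂ} (hΛ : IsPosMap Λ)
    {ρ : Matrix (q × q) (q × q) ℂ} (hρ : Separable ρ) :
    0 ≤ (idTensor (⇑Λ) (Pplus q) * ρ).trace := by
  obtain ⟨n, c, ρ₁, ρ₂, hc, -, h₁, h₂, rfl⟩ := hρ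
  simp only [Matrix.mul_sum, Matrix.trace_sum, Matrix.mul_smul, Matrix.trace_smul, smul_eq_mul,
    trace_idTensor_Pplus_mul_kronecker]
  refine Finset.sum_nonneg fun i _ => mul_nonneg (Complex.zero_le_real.mpr (hc i))
    (mul_nonneg ?_ ((hΛ _ (h₁ i).1.transpose).trace_mul_nonneg (h₂ i).1))
  rw [← Complex.ofReal_natCast, ← Complex.ofReal_inv]
  exact Complex.zero_le_real.mpr (by positivity)

/-- Proposition 11: if `Λ` is positive, `ρ` is a PPT density matrix and
`D_Λ[ρ] = Tr[((id_d⊗Λ)[P⁺_d])·ρ] < 0`, then `Λ` is not decomposable and `ρ` is entangled. -/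
theorem indecomposable_and_entangled_of_negative_pairing (d : ℕ)
    (Λ : Matrix (Fin d) (Fin d) ℂ →ₗ[ℂ] Matrix (Fin d) (Fin d) ℂ)
    (hΛ : IsPosMap Λ)
    (ρ : Matrix (Fin d × Fin d) (Fin d × Fin d) ℂ)
    (hρ : ρ.PosSemidef) (htr : ρ.trace = 1) (hppt : IsPPT ρ)
    (hD : (idTensor (⇑Λ) (Pplus (Fin d)) * ρ).trace < 0) :
    ¬ Decomposable Λ ∧ ¬ Separable ρ := by
  exact ⟨fun h => (h.trace_nonneg_of_isPPT hρ hppt).not_gt hD,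
    fun h => (h.trace_nonneg_of_isPosMap hΛ).not_gt hD⟩
end
end

section
/- Let I ⊆ L₁₆ be nonempty with N_I elements and ρ_I = (1/N_I) Σ_{(α,β)∈I} P_{αβ}. Then ρ_I is PPT if and only if for every lattice point (α,β) ∈ L₁₆, the number of elements of I lying in the column C_α = {(α,β') : β' ∈ {0,1,2,3}} plus the number of elements of I lying in the row R_β = {(α',β) : α' ∈ {0,1,2,3}}, the point (α,β) itself excluded (i.e., #{β'≠β : (α,β')∈I} + #{α'≠α : (α',β)∈I}), does not exceed N_I/2. -/
open Matrix
open scoped Kronecker ComplexOrder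

noncomputable section

/-- The Pauli matrices; `pauli 0` is the 2×2 identity. -/
def pauli : Fin 4 → Matrix (Fin 2) (Fin 2) ℂ :=
  ![1, !![0, 1; 1, 0], !![0, -Complex.I; Complex.I, 0], !![1, 0; 0, -1]]

/-- `σ_{αβ} = σ_α ⊗ σ_β`, a 4×4 matrix acting on `ℂ⁴ = ℂ²⊗ℂ²`. -/
def sigma2 (α β : Fin 4) : Matrix (Fin 2 × Fin 2) (Fin 2 × Fin 2) ℂ :=
  pauli α ⊗ₖ pauli β

/-- `|Ψ_{αβ}⟩ = (1₄ ⊗ σ_{αβ}) |Ψ⁺₄⟩`. -/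
def PsiLat (α β : Fin 4) : (Fin 2 × Fin 2) × (Fin 2 × Fin 2) → ℂ :=
  ((1 : Matrix (Fin 2 × Fin 2) (Fin 2 × Fin 2) ℂ) ⊗ₖ sigma2 α β).mulVec
    (maxEntVec (Fin 2 × Fin 2))

/-- `P_{αβ} = |Ψ_{αβ}⟩⟨Ψ_{αβ}|`. -/
def PLat (α β : Fin 4) :
    Matrix ((Fin 2 × Fin 2) × (Fin 2 × Fin 2)) ((Fin 2 × Fin 2) × (Fin 2 × Fin 2)) ℂ :=
  vecMulVec (PsiLat α β) (star (PsiLat α β))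

/-- The lattice state `ρ_I = (1/N_I) ∑_{(α,β)∈I} P_{αβ}`. -/
def rhoLat (I : Finset (Fin 4 × Fin 4)) :
    Matrix ((Fin 2 × Fin 2) × (Fin 2 × Fin 2)) ((Fin 2 × Fin 2) × (Fin 2 × Fin 2)) ℂ :=
  (I.card : ℂ)⁻¹ • ∑ p ∈ I, PLat p.1 p.2

/-- The involution `γ ↦ γ + 2` of the Pauli labels: multiplication by `σ₂`, up to a phase. -/
def pauliFlip : Fin 4 → Fin 4 := fun γ => γ + 2

lemma pauliFlip_injective : Function.Injective pauliFlip := add_left_injective 2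

/-- The eigenvalue of the partial transpose of a Bell projection, up to a factor `1/2`. -/
def bellSign (α γ : Fin 4) : ℝ := if α = γ then -1 else 1

lemma PsiLat_apply (α β : Fin 4) (a b c d : Fin 2) :
    PsiLat α β ((a, b), (c, d)) = 1 / 2 * (pauli α c a * pauli β d b) := by
  have h4 : Real.sqrt 4 = 2 := by
    rw [show (4 : ℝ) = 2 ^ 2 by norm_num]; exact Real.sqrt_sq (by norm_num)
  rw [PsiLat, Matrix.mulVec, dotProduct, Fintype.sum_prod_type, Finset.sum_eq_single (a, b),
    Finset.sum_eq_single (a, b)]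
  · simp [maxEntVec, sigma2, h4]
    ring
  · intro x _ hx
    simp [maxEntVec, hx.symm]
  · simp
  · intro x _ hx
    simp [hx.symm]
  · simp

lemma pauli_partialTranspose (α : Fin 4) (a c a' c' : Fin 2) :
    pauli α c a' * star (pauli α c' a) =
      1 / 2 * ∑ γ, (bellSign α γ : ℂ) *
        (pauli (pauliFlip γ) c a * star (pauli (pauliFlip γ) c' a')) := by
  fin_cases α <;> fin_cases a <;> fin_cases c <;> fin_cases a' <;> fin_cases c' <;>
    simp [Fin.sum_univ_four, bellSign, pauliFlip, pauli] <;> norm_num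

lemma pauli_orthogonal (γ γ' : Fin 4) :
    ∑ a, ∑ c, star (pauli γ c a) * pauli γ' c a = if γ = γ' then 2 else 0 := by
  fin_cases γ <;> fin_cases γ' <;> simp [pauli] <;> norm_num

lemma PsiLat_orthonormal (p q : Fin 4 × Fin 4) :
    star (PsiLat p.1 p.2) ⬝ᵥ PsiLat q.1 q.2 = if p = q then 1 else 0 := by
  have h : star (PsiLat p.1 p.2) ⬝ᵥ PsiLat q.1 q.2 =
      1 / 4 * ((∑ a, ∑ c, star (pauli p.1 c a) * pauli q.1 c a) *
        (∑ b, ∑ d, star (pauli p.2 d b) * pauli q.2 d b)) := by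
    simp only [dotProduct, Fintype.sum_prod_type, Pi.star_apply, PsiLat_apply, Fin.sum_univ_two]
    simp
    ring
  rw [h, pauli_orthogonal, pauli_orthogonal]
  simp only [Prod.ext_iff]
  split_ifs <;> simp_all
  norm_num

lemma ptFst_PLat (α β : Fin 4) :
    ptFst (PLat α β) = ∑ q : Fin 4 × Fin 4,
      ((1 / 4 * (bellSign α q.1 * bellSign β q.2) : ℝ) : ℂ) •
        PLat (pauliFlip q.1) (pauliFlip q.2) := by
  ext ⟨⟨a, b⟩, c, d⟩ ⟨⟨a', b'⟩, c', d'⟩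
  have hα := pauli_partialTranspose α a c a' c'
  have hβ := pauli_partialTranspose β b d b' d'
  have h : ptFst (PLat α β) ((a, b), c, d) ((a', b'), c', d') =
      1 / 4 * ((pauli α c a' * star (pauli α c' a)) * (pauli β d b' * star (pauli β d' b))) := by
    simp [ptFst, PLat, vecMulVec_apply, PsiLat_apply, Complex.conj_ofNat]
    ring
  rw [h, hα, hβ, mul_mul_mul_comm, Finset.sum_mul_sum, Matrix.sum_apply, Fintype.sum_prod_type]
  simp only [Finset.mul_sum]
  refine Finset.sum_congr rfl fun γ _ => Finset.sum_congr rfl fun δ _ => ?_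
  simp [PLat, vecMulVec_apply, PsiLat_apply]
  ring

/-- The eigenvalue of the partial transpose of `ρ_I` on the vector labelled by the flip of `q`. -/
def latEigenvalue (I : Finset (Fin 4 × Fin 4)) (q : Fin 4 × Fin 4) : ℝ :=
  (I.card : ℝ)⁻¹ * ∑ p ∈ I, 1 / 4 * (bellSign p.1 q.1 * bellSign p.2 q.2)

lemma ptFst_rhoLat (I : Finset (Fin 4 × Fin 4)) :
    ptFst (rhoLat I) =
      ∑ q, (latEigenvalue I q : ℂ) • PLat (pauliFlip q.1) (pauliFlip q.2) := by
  have h : ptFst (rhoLat I) = (I.card : ℂ)⁻¹ • ∑ p ∈ I, ptFst (PLat p.1 p.2) := by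
    ext x y
    simp [ptFst, rhoLat, Matrix.sum_apply]
  rw [h]
  simp only [ptFst_PLat]
  rw [Finset.sum_comm, Finset.smul_sum]
  refine Finset.sum_congr rfl fun q _ => ?_
  rw [← Finset.sum_smul, smul_smul, latEigenvalue]
  push_cast
  rfl

lemma ptFst_rhoLat_quadraticForm (I : Finset (Fin 4 × Fin 4)) (q : Fin 4 × Fin 4) :
    star (PsiLat (pauliFlip q.1) (pauliFlip q.2)) ⬝ᵥ
      (ptFst (rhoLat I) *ᵥ PsiLat (pauliFlip q.1) (pauliFlip q.2)) = latEigenvalue I q := by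
  have h : ∀ q', PLat (pauliFlip q'.1) (pauliFlip q'.2) *ᵥ
      PsiLat (pauliFlip q.1) (pauliFlip q.2) =
      if q' = q then PsiLat (pauliFlip q.1) (pauliFlip q.2) else 0 := by
    intro q'
    have := PsiLat_orthonormal (pauliFlip q'.1, pauliFlip q'.2) (pauliFlip q.1, pauliFlip q.2)
    simp only [Prod.mk.injEq, pauliFlip_injective.eq_iff, ← Prod.ext_iff] at this
    rw [PLat, vecMulVec_mulVec, this]
    split_ifs with hq <;> simp [hq]
  have h1 := PsiLat_orthonormal (pauliFlip q.1, pauliFlip q.2) (pauliFlip q.1, pauliFlip q.2)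
  simp only [if_true] at h1
  simp [ptFst_rhoLat, Matrix.sum_mulVec, Matrix.smul_mulVec, h, h1]

lemma isPPT_rhoLat_iff (I : Finset (Fin 4 × Fin 4)) :
    IsPPT (rhoLat I) ↔ ∀ q, 0 ≤ latEigenvalue I q := by
  refine ⟨fun h q => ?_, fun h => ?_⟩
  · have := h.dotProduct_mulVec_nonneg (PsiLat (pauliFlip q.1) (pauliFlip q.2))
    rw [ptFst_rhoLat_quadraticForm] at this
    exact_mod_cast this
  · rw [IsPPT, ptFst_rhoLat]
    refine Matrix.posSemidef_sum _ fun q _ => ?_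
    exact (posSemidef_vecMulVec_self_star _).smul (by exact_mod_cast h q)

lemma latEigenvalue_eq (I : Finset (Fin 4 × Fin 4)) (α β : Fin 4) :
    latEigenvalue I (α, β) = (I.card : ℝ)⁻¹ * (1 / 2 * ((I.card : ℝ) / 2 -
      (((I.filter fun p => p.1 = α ∧ p.2 ≠ β).card
        + (I.filter fun p => p.2 = β ∧ p.1 ≠ α).card : ℕ) : ℝ))) := by
  have hc : (I.card : ℝ) / 2 = ∑ _p ∈ I, (1 / 2 : ℝ) := by
    simp [div_eq_mul_inv]
  rw [latEigenvalue, hc, Finset.card_filter, Finset.card_filter]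
  push_cast
  rw [← Finset.sum_add_distrib, ← Finset.sum_sub_distrib]
  congr 1
  rw [Finset.mul_sum I _ (1 / 2)]
  refine Finset.sum_congr rfl fun p _ => ?_
  by_cases h1 : p.1 = α <;> by_cases h2 : p.2 = β <;> simp [bellSign, h1, h2] <;> norm_num

/-- Proposition 15: `ρ_I` is PPT iff for every lattice point `(α,β)`, the number of
elements of `I` in the column `C_α` and the row `R_β` (the point `(α,β)` itself excluded)
does not exceed `N_I/2`. -/
theorem lattice_state_ppt_iff (I : Finset (Fin 4 × Fin 4)) (hI : I.Nonempty) :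
    IsPPT (rhoLat I) ↔
      ∀ α β : Fin 4,
        (((I.filter fun p => p.1 = α ∧ p.2 ≠ β).card
            + (I.filter fun p => p.2 = β ∧ p.1 ≠ α).card : ℕ) : ℝ)
          ≤ (I.card : ℝ) / 2 := by
  have hN : (0 : ℝ) < (I.card : ℝ)⁻¹ := inv_pos.mpr (by exact_mod_cast hI.card_pos)
  rw [isPPT_rhoLat_iff, Prod.forall]
  refine forall_congr' fun α => forall_congr' fun β => ?_
  rw [latEigenvalue_eq, mul_nonneg_iff_of_pos_left hN,
    mul_nonneg_iff_of_pos_left (by norm_num), sub_nonneg]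
end
end

section
/- The rank-6 lattice state ρ₆ = (1/6)(P₀₀ + P₀₁ + P₀₂ + P₃₀ + P₃₁ + P₃₂) on ℂ⁴⊗ℂ⁴ is separable: it is a finite convex combination of projections onto product vectors (explicitly, ρ₆ = (1/12)[P⁽¹⁾₀₊ + P⁽¹⁾₀₋ + P⁽¹⁾₁₊ + P⁽¹⁾₁₋ + P⁽²⁾₀₊ + P⁽²⁾₀₋ + P⁽²⁾₁₊ + P⁽²⁾₁₋ + Q₃ + Q₄ + Q₅ + Q₆], where the P's and Q's are the rank-one projections onto the product vectors |Ψ⁽¹⁾₀±⟩ = ((|00⟩±|01⟩)/√2)⊗((|00⟩±|01⟩)/√2), |Ψ⁽²⁾₀±⟩ = ((|00⟩±i|01⟩)/√2)⊗((|00⟩∓i|01⟩)/√2), |Ψ⁽¹⁾₁±⟩ = ((|10⟩±|11⟩)/√2)⊗((|10⟩±|11⟩)/√2), |Ψ⁽²⁾₁±⟩ = ((|10⟩±i|11⟩)/√2)⊗((|10⟩∓i|11⟩)/√2), |Φ₃⟩ = |00⟩⊗|01⟩, |Φ₄⟩ = |01⟩⊗|00⟩, |Φ₅⟩ = |10⟩⊗|11⟩,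 |Φ₆⟩ = |11⟩⊗|10⟩, with |0⟩, |1⟩ the eigenstates of σ₃). -/
open Matrix
open scoped Kronecker ComplexOrder

noncomputable section

/-- The basis vector `|ab⟩` of `ℂ⁴ = ℂ²⊗ℂ²`, with `|0⟩`, `|1⟩` the eigenstates of `σ₃`. -/
def ket (a b : Fin 2) : Fin 2 × Fin 2 → ℂ := fun q => if q = (a, b) then 1 else 0

/-- The tensor product of two vectors of `ℂ⁴`. -/
def tens (v w : Fin 2 × Fin 2 → ℂ) : (Fin 2 × Fin 2) × (Fin 2 × Fin 2) → ℂ :=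
  fun x => v x.1 * w x.2

/-- The rank-one projection `|u⟩⟨u|`. -/
def proj (u : (Fin 2 × Fin 2) × (Fin 2 × Fin 2) → ℂ) :
    Matrix ((Fin 2 × Fin 2) × (Fin 2 × Fin 2)) ((Fin 2 × Fin 2) × (Fin 2 × Fin 2)) ℂ :=
  vecMulVec u (star u)

/-- `|Ψ⁽¹⁾ₐ±⟩ = ((|a0⟩±|a1⟩)/√2)⊗((|a0⟩±|a1⟩)/√2)`. -/
def psi1 (a : Fin 2) (s : ℂ) : (Fin 2 × Fin 2) × (Fin 2 × Fin 2) → ℂ :=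
  tens ((((Real.sqrt 2 : ℝ) : ℂ))⁻¹ • (ket a 0 + s • ket a 1))
       ((((Real.sqrt 2 : ℝ) : ℂ))⁻¹ • (ket a 0 + s • ket a 1))

/-- `|Ψ⁽²⁾ₐ±⟩ = ((|a0⟩±i|a1⟩)/√2)⊗((|a0⟩∓i|a1⟩)/√2)`. -/
def psi2 (a : Fin 2) (s : ℂ) : (Fin 2 × Fin 2) × (Fin 2 × Fin 2) → ℂ :=
  tens ((((Real.sqrt 2 : ℝ) : ℂ))⁻¹ • (ket a 0 + (s * Complex.I) • ket a 1))
       ((((Real.sqrt 2 : ℝ) : ℂ))⁻¹ • (ket a 0 - (s * Complex.I) • ket a 1))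

/-- The vector `(|a0⟩ + s|a1⟩)/√2` of `ℂ⁴`. -/
def unitPair (a : Fin 2) (s : ℂ) : Fin 2 × Fin 2 → ℂ :=
  (((Real.sqrt 2 : ℝ) : ℂ))⁻¹ • (ket a 0 + s • ket a 1)

lemma psi1_eq (a : Fin 2) (s : ℂ) : psi1 a s = tens (unitPair a s) (unitPair a s) := rfl

lemma psi2_eq (a : Fin 2) (s : ℂ) :
    psi2 a s = tens (unitPair a (s * Complex.I)) (unitPair a (-(s * Complex.I))) := by
  simp [psi2, unitPair, sub_eq_add_neg]

lemma inv_sqrt_two_mul_self :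
    (((Real.sqrt 2 : ℝ) : ℂ))⁻¹ * (((Real.sqrt 2 : ℝ) : ℂ))⁻¹ = 2⁻¹ := by
  rw [← mul_inv, ← Complex.ofReal_mul, Real.mul_self_sqrt (by norm_num)]
  norm_num

lemma ket_normalized (a b : Fin 2) : ket a b ⬝ᵥ star (ket a b) = 1 := by
  simp [dotProduct, ket]

lemma unitPair_normalized (a : Fin 2) (s : ℂ) (hs : s * star s = 1) :
    unitPair a s ⬝ᵥ star (unitPair a s) = 1 := by
  have h := inv_sqrt_two_mul_self
  rw [Complex.star_def] at hs
  fin_cases a <;>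
    simp [unitPair, dotProduct, ket, Fintype.sum_prod_type] <;>
    linear_combination (1 + s * (starRingEnd ℂ) s) * h + 2⁻¹ * hs

lemma proj_tens (v w : Fin 2 × Fin 2 → ℂ) :
    proj (tens v w) = vecMulVec v (star v) ⊗ₖ vecMulVec w (star w) := by
  ext x y
  simp only [proj, tens, vecMulVec_apply, kroneckerMap_apply, Pi.star_apply, star_mul']
  ring

lemma separable_uniform_mixture {n : ℕ} (hn : n ≠ 0) (v w : Fin n → Fin 2 × Fin 2 → ℂ)
    (hv : ∀ i, v i ⬝ᵥ star (v i) = 1) (hw : ∀ i, w i ⬝ᵥ star (w i) = 1) :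
    Separable ((n : ℂ)⁻¹ • ∑ i, proj (tens (v i) (w i))) := by
  refine ⟨n, fun _ => (n : ℝ)⁻¹, fun i => vecMulVec (v i) (star (v i)),
    fun i => vecMulVec (w i) (star (w i)), fun _ => by positivity, ?_, fun i => ?_, fun i => ?_, ?_⟩
  · simp [hn]
  · exact ⟨posSemidef_vecMulVec_self_star _, by rw [trace_vecMulVec, hv]⟩
  · exact ⟨posSemidef_vecMulVec_self_star _, by rw [trace_vecMulVec, hw]⟩
  · simp [Finset.smul_sum, proj_tens]

lemma PsiLat_apply_s18 (α β : Fin 4) (x : (Fin 2 × Fin 2) × (Fin 2 × Fin 2)) :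
    PsiLat α β x = 2⁻¹ * (pauli α x.2.1 x.1.1 * pauli β x.2.2 x.1.2) := by
  have h : Real.sqrt 4 = 2 := by
    rw [show (4 : ℝ) = 2 ^ 2 by norm_num, Real.sqrt_sq (by norm_num)]
  simp [PsiLat, mulVec, dotProduct, maxEntVec, sigma2, Fintype.sum_prod_type (α₁ := Fin 2 × Fin 2),
    one_apply, h, mul_comm]

lemma PLat_apply (α β : Fin 4) (x y : (Fin 2 × Fin 2) × (Fin 2 × Fin 2)) :
    PLat α β x y = 4⁻¹ * (pauli α x.2.1 x.1.1 * star (pauli α y.2.1 y.1.1)) *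
      (pauli β x.2.2 x.1.2 * star (pauli β y.2.2 y.1.2)) := by
  simp only [PLat, vecMulVec_apply, Pi.star_apply, PsiLat_apply_s18, star_mul', star_inv₀,
    star_ofNat]
  ring

/-- The one-qubit vector `|0⟩ + s|1⟩`. -/
def qubitPair (s : ℂ) : Fin 2 → ℂ := ![1, s]

lemma unitPair_apply (a : Fin 2) (s : ℂ) (x : Fin 2 × Fin 2) :
    unitPair a s x = (((Real.sqrt 2 : ℝ) : ℂ))⁻¹ *
      ((Pi.single a 1 : Fin 2 → ℂ) x.1 * qubitPair s x.2) := by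
  obtain ⟨b, c⟩ := x
  fin_cases c <;> simp [unitPair, ket, qubitPair, Pi.single_apply]

lemma proj_tens_unitPair_apply (a : Fin 2) (s t : ℂ) (i b k d i' b' k' d' : Fin 2) :
    proj (tens (unitPair a s) (unitPair a t)) ((i, b), (k, d)) ((i', b'), (k', d')) =
      4⁻¹ * (if i = a ∧ k = a ∧ i' = a ∧ k' = a then 1 else 0) *
        (qubitPair s b * qubitPair t d * star (qubitPair s b' * qubitPair t d')) := by
  have h := inv_sqrt_two_mul_self
  simp only [proj, tens, vecMulVec_apply, Pi.star_apply, unitPair_apply, Pi.single_apply]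
  split_ifs <;> simp_all only [and_self, and_true, and_false, not_true_eq_false, mul_zero, zero_mul,
    star_mul', star_zero, one_mul, mul_one, star_inv₀, Complex.star_def,
    Complex.conj_ofReal]
  set r := (((Real.sqrt 2 : ℝ) : ℂ))⁻¹
  linear_combination (r * r + 2⁻¹) * (qubitPair s b * qubitPair t d *
    ((starRingEnd ℂ) (qubitPair s b') * (starRingEnd ℂ) (qubitPair t d'))) * h

lemma proj_tens_ket_apply (a e f i b k d i' b' k' d' : Fin 2) :
    proj (tens (ket a e) (ket a f)) ((i, b), (k, d)) ((i', b'), (k', d')) =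
      (if i = a ∧ k = a ∧ i' = a ∧ k' = a then 1 else 0) *
        (if b = e ∧ d = f ∧ b' = e ∧ d' = f then 1 else 0) := by
  simp only [proj, tens, vecMulVec_apply, Pi.star_apply, ket, Prod.mk.injEq]
  split_ifs <;> simp_all

lemma pauli_zero_three_sum (i k i' k' : Fin 2) :
    pauli 0 k i * star (pauli 0 k' i') + pauli 3 k i * star (pauli 3 k' i') =
      2 * ((if i = 0 ∧ k = 0 ∧ i' = 0 ∧ k' = 0 then 1 else 0) +
        (if i = 1 ∧ k = 1 ∧ i' = 1 ∧ k' = 1 then 1 else 0)) := by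
  fin_cases i <;> fin_cases k <;> fin_cases i' <;> fin_cases k' <;> simp [pauli] <;> norm_num

lemma pauli_zero_one_two_sum (b d b' d' : Fin 2) :
    pauli 0 d b * star (pauli 0 d' b') + pauli 1 d b * star (pauli 1 d' b')
        + pauli 2 d b * star (pauli 2 d' b') =
      4⁻¹ * (qubitPair 1 b * qubitPair 1 d * star (qubitPair 1 b' * qubitPair 1 d')
        + qubitPair (-1) b * qubitPair (-1) d * star (qubitPair (-1) b' * qubitPair (-1) d')
        + qubitPair Complex.I b * qubitPair (-Complex.I) d *
          star (qubitPair Complex.I b' * qubitPair (-Complex.I) d')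
        + qubitPair (-Complex.I) b * qubitPair Complex.I d *
          star (qubitPair (-Complex.I) b' * qubitPair Complex.I d'))
      + (if b = 0 ∧ d = 1 ∧ b' = 0 ∧ d' = 1 then 1 else 0)
      + (if b = 1 ∧ d = 0 ∧ b' = 1 ∧ d' = 0 then 1 else 0) := by
  fin_cases b <;> fin_cases d <;> fin_cases b' <;> fin_cases d' <;>
    simp [pauli, qubitPair] <;> norm_num

lemma rank_six_lattice_state_eq :
    (6 : ℂ)⁻¹ • (PLat 0 0 + PLat 0 1 + PLat 0 2 + PLat 3 0 + PLat 3 1 + PLat 3 2)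
        = (12 : ℂ)⁻¹ •
          (proj (psi1 0 1) + proj (psi1 0 (-1)) + proj (psi1 1 1) + proj (psi1 1 (-1))
            + proj (psi2 0 1) + proj (psi2 0 (-1)) + proj (psi2 1 1) + proj (psi2 1 (-1))
            + proj (tens (ket 0 0) (ket 0 1)) + proj (tens (ket 0 1) (ket 0 0))
            + proj (tens (ket 1 0) (ket 1 1)) + proj (tens (ket 1 1) (ket 1 0))) := by
  ext ⟨⟨i, b⟩, ⟨k, d⟩⟩ ⟨⟨i', b'⟩, ⟨k', d'⟩⟩
  simp only [Matrix.smul_apply, Matrix.add_apply, smul_eq_mul, PLat_apply, psi1_eq, psi2_eq,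
    proj_tens_unitPair_apply, proj_tens_ket_apply, one_mul, neg_one_mul, neg_neg]
  have h₁ := pauli_zero_three_sum i k i' k'
  have h₂ := pauli_zero_one_two_sum b d b' d'
  linear_combination 24⁻¹ * (pauli 0 d b * star (pauli 0 d' b')
      + pauli 1 d b * star (pauli 1 d' b') + pauli 2 d b * star (pauli 2 d' b')) * h₁
    + 12⁻¹ * ((if i = 0 ∧ k = 0 ∧ i' = 0 ∧ k' = 0 then 1 else 0) +
        (if i = 1 ∧ k = 1 ∧ i' = 1 ∧ k' = 1 then 1 else 0)) * h₂

/-- The separability of the rank-6 lattice state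
`ρ₆ = (P₀₀+P₀₁+P₀₂+P₃₀+P₃₁+P₃₂)/6`, with its explicit decomposition into projections
onto product vectors. -/
theorem rank_six_lattice_state_separable :
    ((6 : ℂ)⁻¹ • (PLat 0 0 + PLat 0 1 + PLat 0 2 + PLat 3 0 + PLat 3 1 + PLat 3 2)
        = (12 : ℂ)⁻¹ •
          (proj (psi1 0 1) + proj (psi1 0 (-1)) + proj (psi1 1 1) + proj (psi1 1 (-1))
            + proj (psi2 0 1) + proj (psi2 0 (-1)) + proj (psi2 1 1) + proj (psi2 1 (-1))
            + proj (tens (ket 0 0) (ket 0 1)) + proj (tens (ket 0 1) (ket 0 0))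
            + proj (tens (ket 1 0) (ket 1 1)) + proj (tens (ket 1 1) (ket 1 0))))
      ∧ Separable
          ((6 : ℂ)⁻¹ • (PLat 0 0 + PLat 0 1 + PLat 0 2 + PLat 3 0 + PLat 3 1 + PLat 3 2)) := by
  have h := rank_six_lattice_state_eq
  refine ⟨h, ?_⟩
  rw [h]
  have hs := separable_uniform_mixture (n := 12) (by norm_num)
    ![unitPair 0 1, unitPair 0 (-1), unitPair 1 1, unitPair 1 (-1),
      unitPair 0 Complex.I, unitPair 0 (-Complex.I), unitPair 1 Complex.I,
      unitPair 1 (-Complex.I), ket 0 0, ket 0 1, ket 1 0, ket 1 1]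
    ![unitPair 0 1, unitPair 0 (-1), unitPair 1 1, unitPair 1 (-1),
      unitPair 0 (-Complex.I), unitPair 0 Complex.I, unitPair 1 (-Complex.I),
      unitPair 1 Complex.I, ket 0 1, ket 0 0, ket 1 1, ket 1 0]
    (by simp [Fin.forall_fin_succ, ket_normalized, unitPair_normalized])
    (by simp [Fin.forall_fin_succ, ket_normalized, unitPair_normalized])
  convert hs using 2
  · norm_num
  · simp [Fin.sum_univ_succ, psi1_eq, psi2_eq, add_assoc]
end
end
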